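/- arXiv:1505.07775 — 3 statements merged into one kernel-verified Lean document; each statement's English description precedes it below -/
import Mathlib

section
/- Let S, N, M be real symmetric 2×2 matrices with S positive definite, and let E : (r₀,∞) → Mat₂(ℝ) satisfy ‖E(r)‖ = O(r⁻¹) as r → ∞. Set G(r) = r²·S + r·N + M + E(r) and n = tr(S⁻¹N). Then √(det G(r)) = √(det S)·(r + n/4)² + O(1) as r → ∞. (This is the paper's statement σ = σ_s·r̂² + O(1) for the area density σ = √(det g_{AB}) with r̂ = r + n/4, eq. (53a), showing r̂ is the best affine approximation of the luminosity distance.) -/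
open Matrix Asymptotics Filter

attribute [local instance] Matrix.normedAddCommGroup

theorem abs_sqrt_sub_mul_le {a : ℝ} (ha : 0 ≤ a) (x : ℝ) :
    |√x - a| * a ≤ |x - a ^ 2| := by
  rcases le_total 0 x with hx | hx
  · have h : x - a ^ 2 = (√x - a) * (√x + a) := by
      linear_combination -Real.sq_sqrt hx
    rw [h, abs_mul, abs_of_nonneg (add_nonneg (Real.sqrt_nonneg x) ha)]
    gcongr
    exact le_add_of_nonneg_left (Real.sqrt_nonneg x)
  · rw [Real.sqrt_eq_zero_of_nonpos hx, zero_sub, abs_neg, abs_of_nonneg ha,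
      abs_of_nonpos (by nlinarith)]
    nlinarith

/-- If `f = a² + O(a)` with `a` eventually positive, then `√f = a + O(1)`. -/
theorem isBigO_sqrt_sub_one {α : Type*} {l : Filter α} {f a : α → ℝ}
    (ha : ∀ᶠ x in l, 0 < a x) (h : (fun x => f x - a x ^ 2) =O[l] a) :
    (fun x => √(f x) - a x) =O[l] fun _ => (1 : ℝ) := by
  obtain ⟨C, hC⟩ := h.bound
  refine IsBigO.of_bound C ?_
  filter_upwards [ha, hC] with x hx hCx
  simp only [Real.norm_eq_abs, abs_of_pos hx, abs_one, mul_one] at hCx ⊢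
  exact le_of_mul_le_mul_right ((abs_sqrt_sub_mul_le hx.le _).trans hCx) hx

theorem trace_inv_mul_mul_det_fin_two {K : Type*} [Field K] (S N : Matrix (Fin 2) (Fin 2) K)
    (hS : S.det ≠ 0) :
    (S⁻¹ * N).trace * S.det = (S.adjugate * N).trace := by
  rw [Matrix.inv_def, Ring.inverse_eq_inv', Matrix.smul_mul, Matrix.trace_smul, smul_eq_mul]
  field_simp

/-- The determinant of a quadratic `2 × 2` matrix polynomial, up to `O(r²)`. -/
theorem isBigO_det_sub_quartic (S N : Matrix (Fin 2) (Fin 2) ℝ)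
    (F : ℝ → Matrix (Fin 2) (Fin 2) ℝ)
    (hF : ∀ i j, (fun r => F r i j) =O[atTop] fun _ => (1 : ℝ))
    (n : ℝ) (hn : n * S.det = (S.adjugate * N).trace) :
    (fun r => (r ^ 2 • S + r • N + F r).det - S.det * (r + n / 4) ^ 4) =O[atTop]
      fun r => r ^ 2 := by
  have mul {f g : ℝ → ℝ} (hf : f =O[atTop] fun _ => (1 : ℝ))
      (hg : g =O[atTop] fun _ => (1 : ℝ)) : (fun r => f r * g r) =O[atTop] fun _ => (1 : ℝ) := by
    simpa using hf.mul hg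
  have const (c : ℝ) : (fun _ : ℝ => c) =O[atTop] fun _ => (1 : ℝ) :=
    isBigO_const_const c one_ne_zero atTop
  have inv : (fun r : ℝ => r⁻¹) =O[atTop] fun _ => (1 : ℝ) :=
    tendsto_inv_atTop_zero.isBigO_one ℝ
  have lin (A : Matrix (Fin 2) (Fin 2) ℝ) :
      (fun r => A 1 1 * F r 0 0 + A 0 0 * F r 1 1 - (A 0 1 * F r 1 0 + A 1 0 * F r 0 1))
        =O[atTop] fun _ => (1 : ℝ) :=
    ((mul (const _) (hF _ _)).add (mul (const _) (hF _ _))).sub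
      ((mul (const _) (hF _ _)).add (mul (const _) (hF _ _)))
  have detF := (mul (hF 0 0) (hF 1 1)).sub (mul (hF 0 1) (hF 1 0))
  have total := ((const (N.det - 6 * S.det * (n / 4) ^ 2)).add (lin S)).add
    (mul inv (((lin N).sub (const (4 * S.det * (n / 4) ^ 3))).add
      (mul inv (detF.sub (const (S.det * (n / 4) ^ 4))))))
  refine ((isBigO_refl (fun r : ℝ => r ^ 2) atTop).mul total).congr' ?_ (by simp)
  filter_upwards [eventually_ne_atTop 0] with r hr
  simp only [Matrix.adjugate_fin_two, Matrix.trace_fin_two, Matrix.mul_apply, Fin.sum_univ_two,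
    Matrix.det_fin_two, Matrix.of_apply, Matrix.cons_val', Matrix.cons_val_zero,
    Matrix.cons_val_one, Matrix.cons_val_fin_one, Matrix.add_apply, Matrix.smul_apply,
    smul_eq_mul] at hn ⊢
  field_simp
  linear_combination (256 * r ^ 3) * hn

theorem sq_isBigO_mul_add_sq {c : ℝ} (hc : c ≠ 0) (b : ℝ) :
    (fun r : ℝ => r ^ 2) =O[atTop] fun r => c * (r + b) ^ 2 := by
  have h : (fun r : ℝ => r) =O[atTop] fun r => r + b := by
    refine IsBigO.of_bound 2 ?_
    filter_upwards [eventually_ge_atTop (2 * |b|)] with r hr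
    have hb := neg_abs_le b
    have hb' := abs_nonneg b
    rw [Real.norm_eq_abs, Real.norm_eq_abs, abs_of_nonneg (by linarith),
      abs_of_nonneg (by linarith)]
    linarith
  exact (h.pow 2).trans (isBigO_self_const_mul hc _ _)

/-- For `G r = r²S + rN + M + E r` with `S, N, M` symmetric, `S` positive
definite and `‖E r‖ = O(r⁻¹)` as `r → ∞`, one has
`√(det G r) = √(det S)·(r + n/4)² + O(1)` as `r → ∞`, where `n = tr(S⁻¹N)`.
This is eq. (53a): `σ = σ_s r̂² + O(1)` with `r̂ = r + n/4`. -/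
theorem area_density_expansion
    (S N M : Matrix (Fin 2) (Fin 2) ℝ)
    (hS : S.IsSymm) (hN : N.IsSymm) (hM : M.IsSymm)
    (hSpos : S.PosDef)
    (E : ℝ → Matrix (Fin 2) (Fin 2) ℝ)
    (hE : (fun r => ‖E r‖) =O[atTop] fun r => r⁻¹)
    (G : ℝ → Matrix (Fin 2) (Fin 2) ℝ)
    (hG : ∀ r, G r = r ^ 2 • S + r • N + M + E r)
    (n : ℝ) (hn : n = (S⁻¹ * N).trace) :
    (fun r => Real.sqrt (G r).det - Real.sqrt S.det * (r + n / 4) ^ 2) =O[atTop]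
      fun _ => (1 : ℝ) := by
  have hdet : 0 < S.det := hSpos.det_pos
  have hc : 0 < √S.det := Real.sqrt_pos.2 hdet
  have hF (i j : Fin 2) : (fun r => (M + E r) i j) =O[atTop] fun _ => (1 : ℝ) := by
    have hEij : (fun r => E r i j) =O[atTop] fun r => ‖E r‖ :=
      IsBigO.of_bound 1 (Eventually.of_forall fun r => by
        simpa using Matrix.norm_entry_le_entrywise_sup_norm (E r))
    exact (isBigO_const_const (M i j) one_ne_zero atTop).add
      ((hEij.trans hE).trans (tendsto_inv_atTop_zero.isBigO_one ℝ))
  have hquartic := isBigO_det_sub_quartic S N (fun r => M + E r) hF n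
    (hn ▸ trace_inv_mul_mul_det_fin_two S N hdet.ne')
  refine isBigO_sqrt_sub_one ?_
    ((hquartic.trans (sq_isBigO_mul_add_sq hc.ne' (n / 4))).congr_left fun r => ?_)
  · filter_upwards [eventually_gt_atTop (-(n / 4))] with r hr
    have : 0 < r + n / 4 := by linarith
    positivity
  · rw [hG, add_assoc _ M, mul_pow, Real.sq_sqrt hdet.le, ← pow_mul]
end

section
/- Let 0 < a < m be real numbers, set Δ(r) = r² − 2mr + a², Σ²(r,θ) = (r² + a²)² − a²Δ(r)sin²θ, Δ̃(r) = √(r⁴ + a²r² + 2a²mr), and r_H = m + √(m² − a²). Then for every r > r_H and every θ ∈ ℝ: Δ(r) > 0 and Σ²(r,θ)/Δ(r) − Δ̃(r)²/Δ(r) − a²cos²θ = 0. Consequently, for ε, ε̃ ∈ {−1, 1}, any function u(t,r,θ) = t + ε(F(r) + ε̃·a·sinθ) with F′(r) = Δ̃(r)/Δ(r) satisfies the Kerr eikonal equation (Σ²/(ρ²Δ))(∂_t u)² − (Δ/ρ²)(∂_r u)² − (1/ρ²)(∂_θ u)² = 0 on {r > r_H}, where ρ² = r² + a²cos²θ. 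-/
/-- The Kerr horizon function is positive outside the larger root. -/
lemma kerr_delta_pos {a m r : ℝ} (hr : m + √(m ^ 2 - a ^ 2) < r) :
    0 < r ^ 2 - 2 * m * r + a ^ 2 := by
  have h : m ^ 2 - a ^ 2 < (r - m) ^ 2 :=
    Real.lt_sq_of_sqrt_lt (by linarith)
  linarith [h, show (r - m) ^ 2 = r ^ 2 - 2 * m * r + m ^ 2 by ring]

/-- The square of the radical `Δ̃`, in terms of `Σ²` and `Δ`. -/
lemma kerr_sqrt_sq {a m r : ℝ} (hm : 0 ≤ m) (hr : 0 ≤ r) (θ : ℝ) :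
    √(r ^ 4 + a ^ 2 * r ^ 2 + 2 * a ^ 2 * m * r) ^ 2 =
      (r ^ 2 + a ^ 2) ^ 2 - a ^ 2 * (r ^ 2 - 2 * m * r + a ^ 2) * Real.sin θ ^ 2
        - a ^ 2 * Real.cos θ ^ 2 * (r ^ 2 - 2 * m * r + a ^ 2) := by
  rw [Real.sq_sqrt (by positivity), Real.sin_sq]
  ring

/-- For the Kerr metric with `0 < a < m`, with
`Δ(r) = r² − 2mr + a²`, `Σ²(r,θ) = (r²+a²)² − a²Δ(r)sin²θ`,
`Δ̃(r) = √(r⁴ + a²r² + 2a²mr)` and `r_H = m + √(m² − a²)`: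
for every `r > r_H` we have `Δ(r) > 0` and
`Σ²/Δ − Δ̃²/Δ − a²cos²θ = 0`; consequently any
`u(t,r,θ) = t + ε(F(r) + ε̃ a sinθ)` with `F' = Δ̃/Δ` satisfies the Kerr eikonal
equation `(Σ²/(ρ²Δ))(∂_t u)² − (Δ/ρ²)(∂_r u)² − (1/ρ²)(∂_θ u)² = 0` on `{r > r_H}`,
where `ρ² = r² + a²cos²θ`.  (Eq. (57) of the paper.) -/
theorem kerr_eikonal
    (a m : ℝ) (ha : 0 < a) (ham : a < m)
    (Δ Δt : ℝ → ℝ) (Sig2 : ℝ → ℝ → ℝ) (rH : ℝ)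
    (hΔ : ∀ r, Δ r = r ^ 2 - 2 * m * r + a ^ 2)
    (hSig2 : ∀ r θ, Sig2 r θ = (r ^ 2 + a ^ 2) ^ 2 - a ^ 2 * Δ r * Real.sin θ ^ 2)
    (hΔt : ∀ r, Δt r = Real.sqrt (r ^ 4 + a ^ 2 * r ^ 2 + 2 * a ^ 2 * m * r))
    (hrH : rH = m + Real.sqrt (m ^ 2 - a ^ 2)) :
    (∀ r > rH, ∀ θ : ℝ,
      0 < Δ r ∧ Sig2 r θ / Δ r - (Δt r) ^ 2 / Δ r - a ^ 2 * Real.cos θ ^ 2 = 0) ∧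
    (∀ ε εt : ℝ, (ε = 1 ∨ ε = -1) → (εt = 1 ∨ εt = -1) →
      ∀ F : ℝ → ℝ, (∀ r > rH, HasDerivAt F (Δt r / Δ r) r) →
      ∀ u : ℝ → ℝ → ℝ → ℝ,
        (∀ t r θ, u t r θ = t + ε * (F r + εt * a * Real.sin θ)) →
        ∀ t : ℝ, ∀ r > rH, ∀ θ : ℝ,
          Sig2 r θ / ((r ^ 2 + a ^ 2 * Real.cos θ ^ 2) * Δ r)
              * (deriv (fun t' => u t' r θ) t) ^ 2
            - Δ r / (r ^ 2 + a ^ 2 * Real.cos θ ^ 2)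
              * (deriv (fun r' => u t r' θ) r) ^ 2
            - 1 / (r ^ 2 + a ^ 2 * Real.cos θ ^ 2)
              * (deriv (fun θ' => u t r θ') θ) ^ 2 = 0) := by
  have hr_pos : ∀ r > rH, 0 < r := fun r hr => by
    have := Real.sqrt_nonneg (m ^ 2 - a ^ 2)
    linarith
  have hΔ_pos : ∀ r > rH, 0 < Δ r := fun r hr => by
    rw [hΔ]
    exact kerr_delta_pos (hrH ▸ hr)
  have hΔt_sq : ∀ r > rH, ∀ θ, Δt r ^ 2 = Sig2 r θ - a ^ 2 * Real.cos θ ^ 2 * Δ r := by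
    intro r hr θ
    rw [hΔt, hSig2, hΔ]
    exact kerr_sqrt_sq (ha.trans ham).le (hr_pos r hr).le θ
  refine ⟨fun r hr θ => ⟨hΔ_pos r hr, ?_⟩, ?_⟩
  · have hΔ_ne := (hΔ_pos r hr).ne'
    rw [hΔt_sq r hr θ]
    field_simp
    ring
  · intro ε εt hε hεt F hF u hu t r hr θ
    have hΔ_ne := (hΔ_pos r hr).ne'
    have hr_pos := hr_pos r hr
    have hρ_ne : r ^ 2 + a ^ 2 * Real.cos θ ^ 2 ≠ 0 := by positivity
    have hε_sq : ε ^ 2 = 1 := by rcases hε with rfl | rfl <;> norm_num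
    have hεt_sq : εt ^ 2 = 1 := by rcases hεt with rfl | rfl <;> norm_num
    simp only [hu]
    rw [((hasDerivAt_id' t).add_const _).deriv,
      ((((hF r hr).add_const _).const_mul ε).const_add t).deriv,
      (((((Real.hasDerivAt_sin θ).const_mul (εt * a)).const_add (F r)).const_mul ε).const_add
        t).deriv]
    simp only [mul_pow, div_pow, hε_sq, hεt_sq, hΔt_sq r hr θ]
    field_simp
    ring
end

section
/- Let 0 < a < m, r_H = m + √(m² − a²), Δ̃(r) = √(r⁴ + a²r² + 2a²mr), ε̃ ∈ {−1, 1}, and f(r) = ∫_{r_H}^r dr′/Δ̃(r′) for r ≥ r_H. Then the function ξ(r,θ) = e^{ε̃·a·f(r)}·tan(θ/2 − π/4) satisfies the first-order linear partial differential equation Δ̃(r)·∂_r ξ + ε̃·a·cosθ·∂_θ ξ = 0 for all r > r_H and θ ∈ (0,π). -/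
/-- The function `r ↦ ∫_{r₀}^r dr'/g(r')` has derivative `1 / g r` when `g` is continuous and
positive on the positive half-line. -/
theorem hasDerivAt_integral_one_div_of_pos {g : ℝ → ℝ} (hg : Continuous g)
    (hpos : ∀ x, 0 < x → 0 < g x) {r₀ r : ℝ} (hr₀ : 0 < r₀) (hr : 0 < r) :
    HasDerivAt (fun x => ∫ t in r₀..x, 1 / g t) (1 / g r) r := by
  have hc : ContinuousOn (fun t => 1 / g t) (Set.Ioi 0) :=
    continuousOn_const.div hg.continuousOn fun x hx => (hpos x hx).ne'
  have hsub : Set.uIcc r₀ r ⊆ Set.Ioi 0 := fun x hx =>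
    lt_of_lt_of_le (lt_min hr₀ hr) hx.1
  exact intervalIntegral.integral_hasDerivAt_right (hc.mono hsub).intervalIntegrable
    (hc.stronglyMeasurableAtFilter isOpen_Ioi r hr) (hc.continuousAt (Ioi_mem_nhds hr))

/-- The half-angle function `u(θ) = tan(θ/2 − π/4)` solves `cos θ · u' = -u`. -/
theorem cos_mul_deriv_tan_half_sub (θ : ℝ) :
    Real.cos θ * (1 / Real.cos (θ / 2 - Real.pi / 4) ^ 2 * (1 / 2)) =
      -Real.tan (θ / 2 - Real.pi / 4) := by
  have hcos : Real.cos θ =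
      -(2 * Real.sin (θ / 2 - Real.pi / 4) * Real.cos (θ / 2 - Real.pi / 4)) := by
    rw [← Real.sin_two_mul, ← Real.cos_add_pi_div_two]
    congr 1
    ring
  rw [hcos, Real.tan_eq_sin_div_cos]
  field_simp

/-- With `0 < a < m`, `r_H = m + √(m²−a²)`,
`Δ̃(r) = √(r⁴ + a²r² + 2a²mr)`, `ε̃ = ±1` and `f(r) = ∫_{r_H}^r dr'/Δ̃(r')`, the function
`ξ(r,θ) = e^{ε̃ a f(r)} tan(θ/2 − π/4)` satisfies
`Δ̃ ∂_r ξ + ε̃ a cosθ ∂_θ ξ = 0` for all `r > r_H`, `θ ∈ (0,π)`.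
(Eqs. (62), (62a) of the paper: `θ̃` is annihilated by the null generators.) -/
theorem kerr_angular_coordinate_pde
    (a m : ℝ) (ha : 0 < a) (ham : a < m)
    (rH : ℝ) (hrH : rH = m + Real.sqrt (m ^ 2 - a ^ 2))
    (Δt : ℝ → ℝ)
    (hΔt : ∀ r, Δt r = Real.sqrt (r ^ 4 + a ^ 2 * r ^ 2 + 2 * a ^ 2 * m * r))
    (εt : ℝ) (hεt : εt = 1 ∨ εt = -1)
    (f : ℝ → ℝ) (hf : ∀ r, f r = ∫ r' in rH..r, 1 / Δt r')
    (ξ : ℝ → ℝ → ℝ)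
    (hξ : ∀ r θ, ξ r θ =
      Real.exp (εt * a * f r) * Real.tan (θ / 2 - Real.pi / 4)) :
    ∀ r > rH, ∀ θ ∈ Set.Ioo 0 Real.pi,
      Δt r * deriv (fun r' => ξ r' θ) r
        + εt * a * Real.cos θ * deriv (fun θ' => ξ r θ') θ = 0 := by
  intro r hr θ hθ
  have hm : 0 < m := ha.trans ham
  have hrH0 : 0 < rH := by rw [hrH]; positivity
  have hr0 : 0 < r := hrH0.trans hr
  have hpos : ∀ x, 0 < x → 0 < Δt x := fun x hx => by
    rw [hΔt]; positivity
  have hcont : Continuous Δt := by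
    rw [funext hΔt]; fun_prop
  have hfd : HasDerivAt f (1 / Δt r) r := by
    rw [funext hf]
    exact hasDerivAt_integral_one_div_of_pos hcont hpos hrH0 hr0
  have hcos : Real.cos (θ / 2 - Real.pi / 4) ≠ 0 := by
    refine (Real.cos_pos_of_mem_Ioo ⟨?_, ?_⟩).ne' <;> linarith [hθ.1, hθ.2, Real.pi_pos]
  have hdr : HasDerivAt (fun r' => ξ r' θ)
      (Real.exp (εt * a * f r) * (εt * a * (1 / Δt r)) * Real.tan (θ / 2 - Real.pi / 4)) r := by
    simp only [hξ]
    exact ((hfd.const_mul (εt * a)).exp).mul_const _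
  have hdθ : HasDerivAt (fun θ' => ξ r θ')
      (Real.exp (εt * a * f r) *
        (1 / Real.cos (θ / 2 - Real.pi / 4) ^ 2 * (1 / 2))) θ := by
    simp only [hξ]
    exact ((Real.hasDerivAt_tan hcos).comp θ
      (((hasDerivAt_id θ).div_const 2).sub_const (Real.pi / 4))).const_mul _
  have hΔ : Δt r * (1 / Δt r) = 1 := mul_one_div_cancel (hpos r hr0).ne'
  rw [hdr.deriv, hdθ.deriv]
  linear_combination
    Real.exp (εt * a * f r) * εt * a * Real.tan (θ / 2 - Real.pi / 4) * hΔ +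
      εt * a * Real.exp (εt * a * f r) * cos_mul_deriv_tan_half_sub θ
end
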